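/- Let G₁ and G₂ be nontrivial finitely generated groups with finite generating sets S₁ and S₂, and let p_c be the critical probability of the Cayley graph of G₁*G₂ with respect to S₁ ⊔ S₂. Then for every p with 0 ≤ p < p_c: χ₁(p) and χ₂(p) are finite, χ₁(p) + χ₂(p) − χ₁(p)·χ₂(p) > 0, and the expected cluster size of the identity in the Cayley graph of G₁*G₂ equals χ₁(p)·χ₂(p) / (χ₁(p) + χ₂(p) − χ₁(p)·χ₂(p)). -/

import Mathlib

open MeasureTheory ENNReal

namespace Perc

/-- Percolation configurations on the edge set `E`: each edge is `true` (open) or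
`false` (closed). -/
abbrev Config (E : Type*) := E → Bool

/-- `μ` is the Bernoulli product measure `P_p` with parameter `p` on `{0,1}^E`: the measure
of every finite cylinder event is the corresponding product.  (This determines `μ` uniquely
on the product σ-algebra, since cylinders form a π-system generating it.) -/
def IsBernoulli {E : Type*} (p : ℝ) (μ : Measure (Config E)) : Prop :=
  ∀ (F : Finset E) (σ : E → Bool),
    μ {ω | ∀ e ∈ F, ω e = σ e} =
      ∏ e ∈ F, ENNReal.ofReal (if σ e then p else 1 - p)

variable {G ι : Type*} [Group G]

/-- In the Cayley graph of `G` with edge set `G × ι`, where the edge `(a, i)` joins `a` and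
`a * f i` (the function `f : ι → G` lists the generators, with multiplicity), this says that
vertices `a` and `b` are joined by some open edge of the configuration `ω`. -/
def Step (f : ι → G) (ω : Config (G × ι)) (a b : G) : Prop :=
  ∃ i : ι, (ω (a, i) = true ∧ b = a * f i) ∨ (ω (b, i) = true ∧ a = b * f i)

/-- `x` and `y` are connected by a path of open edges (`x ↔ y`). -/
def Conn (f : ι → G) (ω : Config (G × ι)) (x y : G) : Prop :=
  Relation.ReflTransGen (Step f ω) x y

/-- The open cluster `C` of the identity. -/
def cluster (f : ι → G) (ω : Config (G × ι)) : Set G :=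
  {x | Conn f ω 1 x}

/-- The percolation function `θ`: the probability that the cluster of the identity is
infinite. -/
noncomputable def theta (f : ι → G) (μ : Measure (Config (G × ι))) : ℝ :=
  (μ {ω | (cluster f ω).Infinite}).toReal

/-- The expected cluster size `χ = E(|C|) ∈ [0,∞]` (where `|C| ∈ ℕ∞` is coerced
to `ℝ≥0∞`). -/
noncomputable def chi (f : ι → G) (μ : Measure (Config (G × ι))) : ℝ≥0∞ :=
  ∫⁻ ω, ((cluster f ω).encard : ℝ≥0∞) ∂μ

/-- The critical probability `p_c = inf {p ∈ [0,1] | θ(p) > 0}`, with the convention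
`p_c = 1` if `θ` vanishes on `[0,1]`; here `μ p` is the percolation measure at
parameter `p`. -/
noncomputable def pc (f : ι → G) (μ : ℝ → Measure (Config (G × ι))) : ℝ :=
  sInf ({p | p ∈ Set.Icc (0 : ℝ) 1 ∧ 0 < theta f (μ p)} ∪ {1})

/-- The word metric on `G` with respect to the generators `f i`: the length of a shortest
word in the generators and their inverses taking `x` to `y`.  (When the generators generate
`G`, this is the graph distance in the Cayley graph.) -/
noncomputable def wdist (f : ι → G) (x y : G) : ℕ :=
  sInf {n : ℕ | ∃ l : List G, l.length = n ∧
    (∀ g ∈ l, (∃ i, f i = g) ∨ (∃ i, (f i)⁻¹ = g)) ∧ x * l.prod = y}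

/-- Schonmann's critical point
`p_exp = sup {p ∈ [0,1] | ∃ c > 0, γ > 0, ∀ x y, P_p(x ↔ y) ≤ c·exp(-γ·dist(x,y))}`. -/
noncomputable def pexp (f : ι → G) (μ : ℝ → Measure (Config (G × ι))) : ℝ :=
  sSup {p | p ∈ Set.Icc (0 : ℝ) 1 ∧ ∃ c > 0, ∃ γ > 0, ∀ x y : G,
    (μ p {ω | Conn f ω x y}).toReal ≤ c * Real.exp (-γ * (wdist f x y : ℝ))}

/-- The walk-through function `g(p,t) = 1 - ∑_{n≥1} (1-t)^{n-1} P_p(|C| = n)` of a Cayley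
graph; here `μ` is the percolation measure at parameter `p`. -/
noncomputable def wt (f : ι → G) (μ : Measure (Config (G × ι))) (t : ℝ) : ℝ :=
  1 - ∑' n : ℕ, (1 - t) ^ n * (μ {ω | (cluster f ω).encard = ((n + 1 : ℕ) : ℕ∞)}).toReal

/-- The ball of radius `j`: all products of at most `j` elements of `S ∪ S⁻¹`. -/
def ball (S : Set G) (j : ℕ) : Set G :=
  {g | ∃ l : List G, l.length ≤ j ∧ (∀ x ∈ l, x ∈ S ∨ x⁻¹ ∈ S) ∧ l.prod = g}

/-- The Cheeger constant `h = inf_K |∂K| / |K|`, the infimum over nonempty finite vertex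
sets `K` of the number of edges `(a, i)` (joining `a` and `a * f i`) with exactly one
endpoint in `K`, divided by `|K|`. -/
noncomputable def cheeger (f : ι → G) : ℝ :=
  ⨅ K : {K : Finset G // K.Nonempty},
    (Nat.card {e : G × ι // Xor' (e.1 ∈ K.1) (e.1 * f e.2 ∈ K.1)} : ℝ) / (K.1.card : ℝ)

/-- The open cluster of the identity in the subgraph induced on the vertex set `V`: only
open edges with both endpoints in `V` may be used. -/
def clusterIn (f : ι → G) (V : Set G) (ω : Config (G × ι)) : Set G :=
  {x | Relation.ReflTransGen (fun a b => Step f ω a b ∧ a ∈ V ∧ b ∈ V) 1 x}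

/-- The generators of `G` given by a generating set `S` (one edge orbit per element
of `S`). -/
def setGens (S : Set G) : S → G := Subtype.val

/-- The generators of the free product `G₁ * G₂` given by the disjoint union `S₁ ⊔ S₂` of
generating sets, embedded via the canonical monomorphisms. -/
def coprodGens {G₁ G₂ : Type*} [Group G₁] [Group G₂] (S₁ : Set G₁) (S₂ : Set G₂) :
    S₁ ⊕ S₂ → Monoid.Coprod G₁ G₂ :=
  Sum.elim (fun s => Monoid.Coprod.inl (s : G₁)) (fun s => Monoid.Coprod.inr (s : G₂))

/-- The generators of the free product `G₁ * ⋯ * G_n` given by the disjoint union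
`S₁ ⊔ ⋯ ⊔ S_n` of generating sets, embedded via the canonical monomorphisms. -/
def coprodIGens {n : ℕ} {G : Fin n → Type*} [∀ i, Group (G i)] (S : ∀ i, Set (G i)) :
    (Σ i, S i) → Monoid.CoprodI G :=
  fun x => Monoid.CoprodI.of (x.2 : G x.1)

/-- The image of a list of syllables in the free product `G₁ * G₂`. -/
def sylProd {G₁ G₂ : Type*} [Group G₁] [Group G₂] (l : List (G₁ ⊕ G₂)) :
    Monoid.Coprod G₁ G₂ :=
  (l.map (Sum.elim (fun g => Monoid.Coprod.inl g) (fun h => Monoid.Coprod.inr h))).prod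

/-- The set `P₁` of nontrivial elements of `G₁ * G₂` whose normal form begins with a
nontrivial syllable of `G₁`: elements represented by a nonempty alternating product of
nontrivial syllables, the first syllable lying in `G₁`.  (Such a representation is the
normal form, which is unique.) -/
def beginsLeft {G₁ G₂ : Type*} [Group G₁] [Group G₂] (x : Monoid.Coprod G₁ G₂) : Prop :=
  ∃ l : List (G₁ ⊕ G₂), l ≠ [] ∧ (∀ a ∈ l, a ≠ Sum.inl 1 ∧ a ≠ Sum.inr 1) ∧
    l.Chain' (fun a b => a.isLeft ≠ b.isLeft) ∧
    (∃ g : G₁, l.head? = some (Sum.inl g)) ∧ sylProd l = x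

/-- The set `P₂` of nontrivial elements of `G₁ * G₂` whose normal form begins with a
nontrivial syllable of `G₂`. -/
def beginsRight {G₁ G₂ : Type*} [Group G₁] [Group G₂] (x : Monoid.Coprod G₁ G₂) : Prop :=
  ∃ l : List (G₁ ⊕ G₂), l ≠ [] ∧ (∀ a ∈ l, a ≠ Sum.inl 1 ∧ a ≠ Sum.inr 1) ∧
    l.Chain' (fun a b => a.isLeft ≠ b.isLeft) ∧
    (∃ h : G₂, l.head? = some (Sum.inr h)) ∧ sylProd l = x

end Perc

namespace Perc

open Monoid

section FreeProduct

variable {κ : Type*} [DecidableEq κ] {H : κ → Type*} [∀ i, Group (H i)] [∀ i, DecidableEq (H i)]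

/-- The first syllable of the normal form of `x` if it lies in `H i`, and `1` otherwise. -/
def syl (i : κ) (x : CoprodI H) : H i :=
  (CoprodI.Word.equivPair i (CoprodI.Word.equiv x)).head

/-- The number of syllables of the normal form of `x`. -/
def wlen (x : CoprodI H) : ℕ :=
  (CoprodI.Word.equiv x).toList.length

lemma equiv_apply_prod (w : CoprodI.Word H) : CoprodI.Word.equiv w.prod = w :=
  CoprodI.Word.equiv.apply_symm_apply w

lemma syl_prod_cons_self {i : κ} (h : H i) (w : CoprodI.Word H) (hw : w.fstIdx ≠ some i)
    (hh : h ≠ 1) : syl i (CoprodI.Word.cons h w hw hh).prod = h := by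
  rw [syl, equiv_apply_prod]
  have : CoprodI.Word.cons h w hw hh = CoprodI.Word.rcons ⟨h, w, hw⟩ := by
    simp [CoprodI.Word.rcons, hh]
  rw [this, ← CoprodI.Word.equivPair_symm, Equiv.apply_symm_apply]

lemma syl_of_mul (i : κ) (h : H i) (x : CoprodI H) : syl i (CoprodI.of h * x) = h * syl i x := by
  have : CoprodI.Word.equiv (CoprodI.of h * x) = CoprodI.of h • CoprodI.Word.equiv x := by
    simp [CoprodI.Word.equiv, mul_smul]
  rw [syl, this, CoprodI.Word.equivPair_smul_same]
  rfl

lemma syl_eq_one_of_fstIdx {i : κ} {w : CoprodI.Word H} (hw : w.fstIdx ≠ some i) :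
    syl i w.prod = 1 := by
  rw [syl, equiv_apply_prod, CoprodI.Word.equivPair_eq_of_fstIdx_ne hw]

lemma fstIdx_ne_of_syl {i : κ} {w : CoprodI.Word H} (hw : syl i w.prod = 1) :
    w.fstIdx ≠ some i := by
  rw [syl, equiv_apply_prod] at hw
  intro h
  induction w using CoprodI.Word.consRecOn with
  | empty => simp [CoprodI.Word.fstIdx, CoprodI.Word.empty] at h
  | cons j m w h1 h2 =>
    rw [CoprodI.Word.fstIdx_cons] at h
    obtain rfl := Option.some.inj h
    have := syl_prod_cons_self m w h1 h2
    rw [syl, equiv_apply_prod] at this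
    exact h2 (this.symm.trans hw)

@[simp] lemma syl_one (i : κ) : syl i (1 : CoprodI H) = 1 := by
  rw [← CoprodI.Word.prod_empty]
  exact syl_eq_one_of_fstIdx (by simp [CoprodI.Word.fstIdx, CoprodI.Word.empty])

@[simp] lemma syl_of (i : κ) (h : H i) : syl i (CoprodI.of h) = h := by
  simpa using syl_of_mul i h 1

lemma syl_eq_one_of_ne {i k : κ} (hik : i ≠ k) {x : CoprodI H} (hx : syl k x ≠ 1) :
    syl i x = 1 := by
  obtain ⟨w, rfl⟩ := CoprodI.Word.equiv.symm.surjective x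
  change syl k w.prod ≠ 1 at hx
  change syl i w.prod = 1
  have hk : w.fstIdx = some k := by
    by_contra h
    exact hx (syl_eq_one_of_fstIdx h)
  exact syl_eq_one_of_fstIdx (by simpa [hk] using hik.symm)

lemma syl_of_mul_of_ne {i k : κ} (hik : i ≠ k) {h : H k} {x : CoprodI H} (hh : h ≠ 1)
    (hx : syl k x = 1) : syl i (CoprodI.of h * x) = 1 :=
  syl_eq_one_of_ne hik (by rwa [syl_of_mul, hx, mul_one])

lemma wlen_of_mul {k : κ} {h : H k} {x : CoprodI H} (hh : h ≠ 1)
    (hx : syl k x = 1) : wlen (CoprodI.of h * x) = wlen x + 1 := by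
  obtain ⟨w, rfl⟩ := CoprodI.Word.equiv.symm.surjective x
  change syl k w.prod = 1 at hx
  change wlen (CoprodI.of h * w.prod) = wlen w.prod + 1
  rw [← CoprodI.Word.prod_cons k h w hh (fstIdx_ne_of_syl hx), wlen, wlen, equiv_apply_prod,
    equiv_apply_prod]
  rfl

/-- Induction on the normal form of an element of a free product. -/
lemma syl_induction {P : CoprodI H → Prop} (one : P 1)
    (mul : ∀ (k : κ) (h : H k) (x : CoprodI H), h ≠ 1 → syl k x = 1 → P x →
      P (CoprodI.of h * x)) (x : CoprodI H) : P x := by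
  obtain ⟨w, rfl⟩ := CoprodI.Word.equiv.symm.surjective x
  change P w.prod
  induction w using CoprodI.Word.consRecOn with
  | empty => simpa using one
  | cons j m w h1 h2 ih =>
    rw [CoprodI.Word.prod_cons]
    exact mul j m _ h2 (syl_eq_one_of_fstIdx h1) ih

lemma eq_one_of_syl_eq_one {x : CoprodI H} (hx : ∀ i, syl i x = 1) : x = 1 := by
  induction x using syl_induction with
  | one => rfl
  | mul k h y hh hy _ =>
    refine absurd (hx k) ?_
    rwa [syl_of_mul, hy, mul_one]

/-- Right multiplication by an element of a factor does not change the first syllable in `H i`,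
except within `H i` itself. -/
lemma syl_mul_of (x : CoprodI H) (i j : κ) (u : H j) :
    syl i (x * CoprodI.of u) = syl i x ∨ (j = i ∧ x = CoprodI.of (syl i x)) := by
  induction x using syl_induction generalizing i with
  | one =>
    by_cases hji : j = i
    · exact Or.inr ⟨hji, by simp⟩
    · left
      rw [one_mul, syl_one]
      by_cases hu : u = 1
      · simp [hu]
      · exact syl_eq_one_of_ne (Ne.symm hji) (by rwa [syl_of])
  | mul k h x hh hx ih =>
    rw [mul_assoc]
    by_cases hik : i = k
    · subst hik
      rw [syl_of_mul, syl_of_mul]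
      refine (ih i).imp (fun e => by rw [e]) fun ⟨e, e'⟩ => ⟨e, ?_⟩
      rw [hx, map_one] at e'
      simp [e']
    · left
      rw [syl_of_mul_of_ne hik hh hx]
      rcases ih k with e | ⟨rfl, e⟩
      · exact syl_of_mul_of_ne hik hh (e.trans hx)
      · rw [hx, map_one] at e
        rw [e, one_mul, ← map_mul]
        by_cases hu : h * u = 1
        · simp [hu]
        · exact syl_eq_one_of_ne hik (by rwa [syl_of])

/-- Every element is uniquely an element of `H i` times an element whose normal form does not
begin in `H i`. -/
def sylEquiv (i : κ) : CoprodI H ≃ H i × {x : CoprodI H // syl i x = 1} where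
  toFun x := ⟨syl i x, (CoprodI.of (syl i x))⁻¹ * x, by rw [← map_inv, syl_of_mul]; simp⟩
  invFun y := CoprodI.of y.1 * y.2
  left_inv x := by simp
  right_inv := by
    rintro ⟨h, x, hx⟩
    simp [syl_of_mul, hx]

end FreeProduct

end Perc

namespace Perc

section Bernoulli

open ProbabilityTheory

variable {E A B : Type*} {p : ℝ}

/-- The Bernoulli measure on `{0,1}` as the law of a thresholded uniform variable. -/
noncomputable def coin (p : ℝ) : Measure Bool :=
  (volume.restrict (Set.Ioc (0 : ℝ) 1)).map (fun u => decide (u ≤ p))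

/-- The law of independent uniform labels on the edges. -/
noncomputable def labelLaw (E : Type*) : Measure (E → ℝ) :=
  Measure.infinitePi (fun _ : E => volume.restrict (Set.Ioc (0 : ℝ) 1))

instance : IsProbabilityMeasure (volume.restrict (Set.Ioc (0 : ℝ) 1)) :=
  ⟨by simp⟩

instance : IsProbabilityMeasure (labelLaw E) := by
  unfold labelLaw; infer_instance

lemma measurable_threshold (p : ℝ) : Measurable (fun u : ℝ => decide (u ≤ p)) :=
  measurable_to_bool (by
    have : (fun u : ℝ => decide (u ≤ p)) ⁻¹' {true} = Set.Iic p := by ext; simp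
    rw [this]
    exact measurableSet_Iic)

instance : IsProbabilityMeasure (coin p) :=
  Measure.isProbabilityMeasure_map (measurable_threshold p).aemeasurable

lemma coin_singleton (hp : p ∈ Set.Icc (0 : ℝ) 1) (b : Bool) :
    coin p {b} = ENNReal.ofReal (if b then p else 1 - p) := by
  rw [coin, Measure.map_apply (measurable_threshold p) (by simp),
    Measure.restrict_apply (measurable_threshold p (by simp))]
  cases b
  · have : (fun u : ℝ => decide (u ≤ p)) ⁻¹' {false} ∩ Set.Ioc 0 1 = Set.Ioc p 1 := by
      ext u; simp; grind
    simp [this]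
  · have : (fun u : ℝ => decide (u ≤ p)) ⁻¹' {true} ∩ Set.Ioc 0 1 = Set.Ioc 0 p := by
      ext u; simp; grind
    simp [this]

/-- The Bernoulli product measure. -/
noncomputable def bern (E : Type*) (p : ℝ) : Measure (Config E) :=
  Measure.infinitePi (fun _ : E => coin p)

instance : IsProbabilityMeasure (bern E p) := by
  unfold bern; infer_instance

lemma isBernoulli_bern (hp : p ∈ Set.Icc (0 : ℝ) 1) : IsBernoulli p (bern E p) := by
  intro F σ
  have : {ω : Config E | ∀ e ∈ F, ω e = σ e} = Set.pi F (fun e => {σ e}) := by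
    ext; simp [Set.mem_pi]
  rw [this, bern, Measure.infinitePi_pi _ (by simp)]
  simp [coin_singleton hp]

lemma IsBernoulli.isProbabilityMeasure {μ : Measure (Config E)} (h : IsBernoulli p μ) :
    IsProbabilityMeasure μ :=
  ⟨by simpa using h ∅ (fun _ => true)⟩

lemma IsBernoulli.unique {μ ν : Measure (Config E)} (hμ : IsBernoulli p μ)
    (hν : IsBernoulli p ν) : μ = ν := by
  have := hμ.isProbabilityMeasure
  refine IsProjectiveLimit.unique (P := fun I => μ.map I.restrict) (fun I => rfl) fun I => ?_
  refine Measure.ext_of_singleton fun σ => ?_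
  classical
  have : I.restrict ⁻¹' ({σ} : Set (I → Bool)) = {ω : Config E | ∀ e ∈ I, ω e =
      if h : e ∈ I then σ ⟨e, h⟩ else true} := by
    ext ω
    simp only [Set.mem_preimage, Set.mem_singleton_iff, funext_iff, Subtype.forall,
      Finset.restrict, Set.mem_ofPred_eq]
    exact forall₂_congr fun e he => by simp [he]
  rw [Measure.map_apply (by fun_prop) (by simp), Measure.map_apply (by fun_prop) (by simp), this,
    hμ, hν]

lemma IsBernoulli.map_comp {μ : Measure (Config E)} (h : IsBernoulli p μ) {j : A → E}
    (hj : Function.Injective j) : IsBernoulli p (μ.map (fun ω => ω ∘ j)) := by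
  classical
  intro F σ
  rw [Measure.map_apply (by fun_prop)
    (by
      have : {ω : Config A | ∀ e ∈ F, ω e = σ e} = Set.pi F (fun e => {σ e}) := by
        ext; simp [Set.mem_pi]
      rw [this]
      exact MeasurableSet.pi F.countable_toSet (by simp))]
  have := h (F.image j) (Function.extend j σ fun _ => true)
  simp only [Finset.prod_image fun a _ b _ hab => hj hab, hj.extend_apply, Finset.mem_image,
    forall_exists_index, and_imp, forall_apply_eq_imp_iff₂] at this
  exact this

lemma bern_map_comp (hp : p ∈ Set.Icc (0 : ℝ) 1) {j : A → E} (hj : Function.Injective j) :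
    (bern E p).map (fun ω => ω ∘ j) = bern A p :=
  ((isBernoulli_bern hp).map_comp hj).unique (isBernoulli_bern hp)

lemma bern_preimage_comp (hp : p ∈ Set.Icc (0 : ℝ) 1) {j : A → E} (hj : Function.Injective j)
    {s : Set (Config A)} (hs : MeasurableSet s) :
    bern E p {ω | ω ∘ j ∈ s} = bern A p s := by
  rw [← bern_map_comp hp hj, Measure.map_apply (by fun_prop) hs]
  rfl

lemma measurableSet_comp_mem_iSup (j : A → E) {s : Set (Config A)} (hs : MeasurableSet s) :
    MeasurableSet[⨆ e ∈ Set.range j, MeasurableSpace.comap (fun ω : Config E => ω e)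
      inferInstance] {ω : Config E | ω ∘ j ∈ s} := by
  have : Measurable[⨆ e ∈ Set.range j, MeasurableSpace.comap (fun ω : Config E => ω e)
      inferInstance] (fun ω : Config E => ω ∘ j) := by
    refine @measurable_pi_lambda _ _ _ (_) _ _ fun c => ?_
    have h1 : MeasurableSpace.comap (fun ω : Config E => ω (j c)) inferInstance ≤
        ⨆ e ∈ Set.range j, MeasurableSpace.comap (fun ω : Config E => ω e) inferInstance :=
      le_iSup₂_of_le (j c) ⟨c, rfl⟩ le_rfl
    exact (comap_measurable _).mono h1 le_rfl
  exact this hs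

/-- The restrictions of a Bernoulli configuration to disjoint sets of edges are independent. -/
lemma bern_inter_comp (hp : p ∈ Set.Icc (0 : ℝ) 1) {j : A → E} {k : B → E}
    (hj : Function.Injective j) (hk : Function.Injective k) (hjk : ∀ a b, j a ≠ k b)
    {s : Set (Config A)} {t : Set (Config B)} (hs : MeasurableSet s) (ht : MeasurableSet t) :
    bern E p {ω | ω ∘ j ∈ s ∧ ω ∘ k ∈ t} = bern A p s * bern B p t := by
  have hind : iIndepFun (fun e (ω : Config E) => ω e) (bern E p) := by
    rw [bern]
    exact iIndepFun_infinitePi (X := fun _ => id) (fun _ => measurable_id)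
  have hle : ∀ e, MeasurableSpace.comap (fun ω : Config E => ω e) inferInstance ≤
      MeasurableSpace.pi := fun e => (measurable_pi_apply e).comap_le
  have hdisj : Disjoint (Set.range j) (Set.range k) := by
    rw [Set.disjoint_left]
    rintro _ ⟨a, rfl⟩ ⟨b, hb⟩
    exact hjk a b hb.symm
  have hI := indep_iSup_of_disjoint hle hind hdisj
  rw [← bern_preimage_comp hp hj hs, ← bern_preimage_comp hp hk ht]
  exact (Indep_iff _ _ _).1 hI _ _ (measurableSet_comp_mem_iSup j hs)
    (measurableSet_comp_mem_iSup k ht)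

lemma labelLaw_map_threshold :
    (labelLaw E).map (fun U e => decide (U e ≤ p)) = bern E p := by
  rw [labelLaw, bern, Measure.infinitePi_map_pi _ (f := fun _ u => decide (u ≤ p))
    (fun _ => measurable_threshold p)]
  rfl

/-- An increasing event is at least as likely at the larger parameter, and strictly so if some
configuration of finitely many edges, closed at the smaller and open at the larger parameter,
forces it to change. -/
lemma bern_lt_bern {q : ℝ} (hp : 0 ≤ p) (hpq : p < q) (hq : q ≤ 1) (F : Finset E)
    {s : Set (Config E)} (hs : MeasurableSet s)
    (hmono : ∀ ω ω' : Config E, (∀ e, ω e = true → ω' e = true) → ω ∈ s → ω' ∈ s)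
    (hF : ∀ ω : Config E, (∀ e ∈ F, ω e = false) → ω ∉ s)
    (hF' : ∀ ω : Config E, (∀ e ∈ F, ω e = true) → ω ∈ s) :
    bern E p s < bern E q s := by
  have hm : ∀ r, Measurable (fun (U : E → ℝ) e => decide (U e ≤ r)) := fun r =>
    measurable_pi_lambda _ fun e => (measurable_threshold r).comp (measurable_pi_apply e)
  rw [← labelLaw_map_threshold, ← labelLaw_map_threshold (p := q), Measure.map_apply (hm p) hs,
    Measure.map_apply (hm q) hs]
  set S := fun r : ℝ => (fun (U : E → ℝ) e => decide (U e ≤ r)) ⁻¹' s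
  have hD : MeasurableSet (Set.pi F (fun _ => Set.Ioc p q) : Set (E → ℝ)) :=
    MeasurableSet.pi F.countable_toSet fun _ _ => measurableSet_Ioc
  have hpos : 0 < labelLaw E (Set.pi F (fun _ => Set.Ioc p q)) := by
    rw [labelLaw, Measure.infinitePi_pi _ (fun _ _ => measurableSet_Ioc)]
    refine pos_iff_ne_zero.2 (Finset.prod_ne_zero_iff.2 fun e _ => ?_)
    rw [Measure.restrict_apply measurableSet_Ioc, Set.inter_eq_left.2 (Set.Ioc_subset_Ioc hp hq)]
    simpa using hpq
  have hdisj : Disjoint (S p) (Set.pi F (fun _ => Set.Ioc p q)) := by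
    rw [Set.disjoint_left]
    intro U hU hU'
    refine hF _ (fun e he => ?_) hU
    simpa using (hU' e he).1
  calc labelLaw E (S p) < labelLaw E (S p) + labelLaw E (Set.pi F (fun _ => Set.Ioc p q)) :=
        ENNReal.lt_add_right (measure_ne_top _ _) hpos.ne'
    _ = labelLaw E (S p ∪ Set.pi F (fun _ => Set.Ioc p q)) := (measure_union hdisj hD).symm
    _ ≤ labelLaw E (S q) := by
        refine measure_mono (Set.union_subset (fun U hU => ?_) fun U hU => ?_)
        · refine hmono _ _ (fun e he => ?_) hU
          simp only [decide_eq_true_eq] at he ⊢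
          linarith
        · refine hF' _ fun e he => ?_
          simpa using (hU e he).2

lemma bern_le_bern {q : ℝ} (hpq : p ≤ q) {s : Set (Config E)} (hs : MeasurableSet s)
    (hmono : ∀ ω ω' : Config E, (∀ e, ω e = true → ω' e = true) → ω ∈ s → ω' ∈ s) :
    bern E p s ≤ bern E q s := by
  have hm : ∀ r, Measurable (fun (U : E → ℝ) e => decide (U e ≤ r)) := fun r =>
    measurable_pi_lambda _ fun e => (measurable_threshold r).comp (measurable_pi_apply e)
  rw [← labelLaw_map_threshold, ← labelLaw_map_threshold (p := q), Measure.map_apply (hm p) hs,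
    Measure.map_apply (hm q) hs]
  refine measure_mono fun U hU => hmono _ _ (fun e he => ?_) hU
  simp only [decide_eq_true_eq] at he ⊢
  linarith

end Bernoulli

end Perc

namespace Perc

section Percolation

variable {G G' ι ι' : Type*} [Group G] [Group G'] {f : ι → G} {f' : ι' → G'}

lemma Conn.map {ω : Config (G × ι)} {ω' : Config (G' × ι')} (φ : G → G') (e : ι → ι')
    (hφ : ∀ a i, φ (a * f i) = φ a * f' (e i))
    (hω : ∀ a i, ω (a, i) = true → ω' (φ a, e i) = true) {x y : G} (h : Conn f ω x y) :
    Conn f' ω' (φ x) (φ y) := by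
  refine Relation.ReflTransGen.lift φ ?_ _ _ h
  rintro a b ⟨i, ⟨h1, rfl⟩ | ⟨h1, rfl⟩⟩
  · exact ⟨e i, Or.inl ⟨hω _ _ h1, hφ _ _⟩⟩
  · exact ⟨e i, Or.inr ⟨hω _ _ h1, hφ _ _⟩⟩

lemma Conn.mono {ω ω' : Config (G × ι)} (hω : ∀ e, ω e = true → ω' e = true) {x y : G}
    (h : Conn f ω x y) : Conn f ω' x y :=
  h.map id id (fun _ _ => rfl) fun _ _ => hω _

lemma measurableSet_open {E : Type*} (e : E) : MeasurableSet {ω : Config E | ω e = true} :=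
  (measurable_pi_apply e : Measurable fun ω : Config E => ω e) (measurableSet_singleton true)

lemma measurableSet_step [Countable ι] (f : ι → G) (x y : G) :
    MeasurableSet {ω : Config (G × ι) | Step f ω x y} := by
  have : {ω : Config (G × ι) | Step f ω x y} = ⋃ i : ι,
      ({ω | ω (x, i) = true} ∩ {_ω | y = x * f i}) ∪
        ({ω | ω (y, i) = true} ∩ {_ω | x = y * f i}) := by
    ext; simp [Step]
  rw [this]
  exact MeasurableSet.iUnion fun i =>
    ((measurableSet_open _).inter (.const _)).union ((measurableSet_open _).inter (.const _))

/-- `x` and `y` are joined by a walk of `n` open edges. -/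
def ConnIn (f : ι → G) (ω : Config (G × ι)) (x : G) : ℕ → G → Prop
  | 0, y => x = y
  | n + 1, y => ∃ z, ConnIn f ω x n z ∧ Step f ω z y

lemma conn_iff_exists_connIn {ω : Config (G × ι)} {x y : G} :
    Conn f ω x y ↔ ∃ n, ConnIn f ω x n y := by
  constructor
  · intro h
    induction h with
    | refl => exact ⟨0, rfl⟩
    | tail _ hs ih =>
      obtain ⟨n, hn⟩ := ih
      exact ⟨n + 1, _, hn, hs⟩
  · rintro ⟨n, hn⟩
    induction n generalizing y with
    | zero => exact hn ▸ Relation.ReflTransGen.refl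
    | succ n ih =>
      obtain ⟨z, hz, hs⟩ := hn
      exact (ih hz).tail hs

lemma measurableSet_connIn [Countable G] [Countable ι] (f : ι → G) (x : G) (n : ℕ) (y : G) :
    MeasurableSet {ω : Config (G × ι) | ConnIn f ω x n y} := by
  induction n generalizing y with
  | zero => exact .const _
  | succ n ih =>
    have : {ω : Config (G × ι) | ConnIn f ω x (n + 1) y} = ⋃ z : G,
        {ω | ConnIn f ω x n z} ∩ {ω | Step f ω z y} := by
      ext; simp [ConnIn]
    rw [this]
    exact MeasurableSet.iUnion fun z => (ih z).inter (measurableSet_step f z y)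

lemma measurableSet_conn [Countable G] [Countable ι] (f : ι → G) (x y : G) :
    MeasurableSet {ω : Config (G × ι) | Conn f ω x y} := by
  simp_rw [conn_iff_exists_connIn]
  have : {ω : Config (G × ι) | ∃ n, ConnIn f ω x n y} = ⋃ n, {ω | ConnIn f ω x n y} := by
    ext; simp
  rw [this]
  exact MeasurableSet.iUnion fun n => measurableSet_connIn f x n y

lemma encard_cluster_eq_tsum (ω : Config (G × ι)) :
    ((cluster f ω).encard : ℝ≥0∞) = ∑' x, {ω | Conn f ω 1 x}.indicator 1 ω := by
  rw [← ENNReal.tsum_set_one, tsum_subtype (cluster f ω) (fun _ => (1 : ℝ≥0∞))]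
  rfl

lemma measurable_encard_cluster [Countable G] [Countable ι] (f : ι → G) :
    Measurable fun ω : Config (G × ι) => ((cluster f ω).encard : ℝ≥0∞) := by
  simp_rw [encard_cluster_eq_tsum]
  exact Measurable.tsum fun x => measurable_one.indicator (measurableSet_conn f 1 x)

lemma chi_eq_tsum [Countable G] [Countable ι] (f : ι → G) (μ : Measure (Config (G × ι))) :
    chi f μ = ∑' x, μ {ω | Conn f ω 1 x} := by
  rw [chi]
  simp_rw [encard_cluster_eq_tsum]
  rw [lintegral_tsum fun x => (measurable_one.indicator (measurableSet_conn f 1 x)).aemeasurable]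
  simp_rw [lintegral_indicator_one (measurableSet_conn f 1 _)]

lemma measurableSet_le_encard_cluster [Countable G] [Countable ι] (f : ι → G) (n : ℕ) :
    MeasurableSet {ω : Config (G × ι) | (n : ℕ∞) ≤ (cluster f ω).encard} := by
  have : {ω : Config (G × ι) | (n : ℕ∞) ≤ (cluster f ω).encard} =
      (fun ω => ((cluster f ω).encard : ℝ≥0∞)) ⁻¹' Set.Ici (n : ℝ≥0∞) := by
    ext ω
    simp only [Set.mem_ofPred_eq, Set.mem_preimage, Set.mem_Ici]
    rw [← ENat.toENNReal_le]
    simp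
  rw [this]
  exact measurable_encard_cluster f measurableSet_Ici

/-- The cluster sizes of isomorphic Cayley graphs agree. -/
lemma encard_cluster_comp (φ : G ≃* G') (e : ι ≃ ι') (hφ : ∀ i, φ (f i) = f' (e i))
    (ω : Config (G' × ι')) :
    (cluster f (ω ∘ Prod.map φ e)).encard = (cluster f' ω).encard := by
  have : cluster f' ω = φ '' cluster f (ω ∘ Prod.map φ e) := by
    ext x
    rw [Set.mem_image]
    constructor
    · intro hx
      refine ⟨φ.symm x, ?_, by simp⟩
      have := Conn.map (f' := f) (ω' := ω ∘ Prod.map φ e) φ.symm e.symm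
        (fun a i => by
          apply φ.injective
          simp [hφ]) (fun a i h => by simpa using h) hx
      rwa [map_one] at this
    · rintro ⟨y, hy, rfl⟩
      have := Conn.map (f' := f') (ω' := ω) φ e (fun a i => by simp [hφ]) (fun a i h => h) hy
      rwa [map_one] at this
  rw [this, φ.injective.encard_image]

lemma IsBernoulli.map_cluster {p : ℝ} {μ : Measure (Config (G × ι))}
    {μ' : Measure (Config (G' × ι'))} (hμ : IsBernoulli p μ) (hμ' : IsBernoulli p μ')
    (φ : G ≃* G') (e : ι ≃ ι') : μ = μ'.map (fun ω => ω ∘ Prod.map φ e) :=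
  hμ.unique (hμ'.map_comp (φ.injective.prodMap e.injective))

lemma chi_congr [Countable G] [Countable ι] {p : ℝ} {μ : Measure (Config (G × ι))}
    {μ' : Measure (Config (G' × ι'))} (hμ : IsBernoulli p μ) (hμ' : IsBernoulli p μ')
    (φ : G ≃* G') (e : ι ≃ ι') (hφ : ∀ i, φ (f i) = f' (e i)) : chi f μ = chi f' μ' := by
  rw [hμ.map_cluster hμ' φ e, chi, lintegral_map (measurable_encard_cluster f) (by fun_prop)]
  simp_rw [encard_cluster_comp φ e hφ]
  rfl

lemma measurableSet_infinite_cluster [Countable G] [Countable ι] (f : ι → G) :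
    MeasurableSet {ω : Config (G × ι) | (cluster f ω).Infinite} := by
  have : {ω : Config (G × ι) | (cluster f ω).Infinite} =
      (fun ω => ((cluster f ω).encard : ℝ≥0∞)) ⁻¹' {⊤} := by
    ext ω
    simp
  rw [this]
  exact measurable_encard_cluster f (measurableSet_singleton _)

lemma theta_congr [Countable G] [Countable ι] {p : ℝ} {μ : Measure (Config (G × ι))}
    {μ' : Measure (Config (G' × ι'))} (hμ : IsBernoulli p μ) (hμ' : IsBernoulli p μ')
    (φ : G ≃* G') (e : ι ≃ ι') (hφ : ∀ i, φ (f i) = f' (e i)) : theta f μ = theta f' μ' := by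
  rw [hμ.map_cluster hμ' φ e, theta, Measure.map_apply (by fun_prop)
    (measurableSet_infinite_cluster f), theta]
  congr 2
  ext ω
  simp [← Set.encard_eq_top_iff, encard_cluster_comp φ e hφ]

/-- The probability that `x` belongs to the cluster of the identity. -/
noncomputable def tau (f : ι → G) (p : ℝ) (x : G) : ℝ≥0∞ :=
  bern (G × ι) p {ω | Conn f ω 1 x}

@[simp] lemma tau_one (f : ι → G) (p : ℝ) : tau f p 1 = 1 := by
  have : {ω : Config (G × ι) | Conn f ω 1 1} = Set.univ :=
    Set.eq_univ_of_forall fun _ => Relation.ReflTransGen.refl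
  rw [tau, this, measure_univ]

lemma tau_le_one (f : ι → G) (p : ℝ) (x : G) : tau f p x ≤ 1 :=
  prob_le_one

lemma tau_mono [Countable G] [Countable ι] (f : ι → G) {p q : ℝ} (hpq : p ≤ q) (x : G) :
    tau f p x ≤ tau f q x :=
  bern_le_bern hpq (measurableSet_conn f 1 x) fun _ _ h hω => Conn.mono h hω

lemma tau_gen_lt [Countable G] [Finite ι] {p q : ℝ} (hp : 0 ≤ p) (hpq : p < q)
    (hq : q ≤ 1) {i : ι} (hi : f i ≠ 1) : tau f p (f i) < tau f q (f i) := by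
  classical
  have := Fintype.ofFinite ι
  refine bern_lt_bern hp hpq hq
    (Finset.univ.image (fun j => ((1 : G), j)) ∪ Finset.univ.image (fun j => ((f j)⁻¹, j)))
    (measurableSet_conn f 1 _) (fun _ _ h hω => Conn.mono h hω) (fun ω hω h => ?_) fun ω hω => ?_
  · have key : ∀ x, Conn f ω 1 x → x = 1 := by
      intro x hx
      induction hx with
      | refl => rfl
      | tail _ hs ih =>
        subst ih
        obtain ⟨j, ⟨h1, rfl⟩ | ⟨h1, h2⟩⟩ := hs
        · simp [hω (1, j) (by simp)] at h1
        · obtain rfl := eq_inv_of_mul_eq_one_left h2.symm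
          simp [hω ((f j)⁻¹, j) (by simp)] at h1
    exact hi (key _ h)
  · exact Relation.ReflTransGen.single ⟨i, Or.inl ⟨hω _ (by simp), by simp⟩⟩

/-- The expected number of elements other than the identity in the cluster of the identity. -/
noncomputable def tauSum (f : ι → G) (p : ℝ) : ℝ≥0∞ :=
  ∑' x : {x : G // x ≠ 1}, tau f p x

lemma tsum_tau [Countable G] (f : ι → G) (p : ℝ) : ∑' x, tau f p x = 1 + tauSum f p := by
  rw [← (Summable.tsum_add_tsum_compl (s := ({1} : Set G)) ENNReal.summable ENNReal.summable),
    tsum_singleton (1 : G) (tau f p), tau_one]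
  rfl

lemma tauSum_mono [Countable G] [Countable ι] (f : ι → G) {p q : ℝ} (hpq : p ≤ q) :
    tauSum f p ≤ tauSum f q :=
  ENNReal.tsum_le_tsum fun x => tau_mono f hpq x

lemma tauSum_pos [Countable G] [Finite ι] {q : ℝ} (hq0 : 0 < q) (hq : q ≤ 1) {i : ι}
    (hi : f i ≠ 1) : 0 < tauSum f q :=
  (tau_gen_lt le_rfl hq0 hq hi).bot_lt.trans_le
    (ENNReal.le_tsum (f := fun x : {x : G // x ≠ 1} => tau f q x) ⟨f i, hi⟩)

lemma tauSum_lt [Countable G] [Finite ι] {p q : ℝ} (hp : 0 ≤ p) (hpq : p < q)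
    (hq : q ≤ 1) {i : ι} (hi : f i ≠ 1) (hfin : tauSum f q ≠ ⊤) : tauSum f p < tauSum f q :=
  ENNReal.tsum_lt_tsum (i := ⟨f i, hi⟩) (ne_top_of_le_ne_top hfin (tauSum_mono f hpq.le))
    (fun x => tau_mono f hpq.le x) (tau_gen_lt hp hpq hq hi)

end Percolation

section Restriction

variable {E : Type*}

open Classical in
/-- Extend a configuration on a set of edges by closed edges. -/
noncomputable def extendClosed {K : Set E} (η : Config K) : Config E :=
  fun e => if h : e ∈ K then η ⟨e, h⟩ else false

lemma extendClosed_eq_true {K : Set E} {η : Config K} {e : E} :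
    extendClosed η e = true ↔ ∃ h : e ∈ K, η ⟨e, h⟩ = true := by
  by_cases h : e ∈ K <;> simp [extendClosed, h]

lemma measurable_extendClosed {K : Set E} : Measurable (extendClosed (K := K)) := by
  refine measurable_pi_lambda _ fun e => ?_
  by_cases h : e ∈ K
  · simpa [extendClosed, h] using measurable_pi_apply _
  · simp [extendClosed, h]

end Restriction

open Monoid

/-- A form of the Bonferroni inequality. -/
lemma sum_measureReal_le {Ω α : Type*} [MeasurableSpace Ω] {P : Measure Ω}
    [IsProbabilityMeasure P] {X : α → Set Ω} (hX : ∀ a, MeasurableSet (X a)) {c : ℝ} (hc : 0 ≤ c)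
    (A : Finset α) (h : ∀ a b, a ≠ b → P.real (X a ∩ X b) ≤ c) :
    ∑ a ∈ A, P.real (X a) ≤ P.real (⋃ a ∈ A, X a) + (A.card : ℝ) ^ 2 * c := by
  classical
  induction A using Finset.induction_on with
  | empty => simp
  | insert a A ha ih =>
    rw [Finset.sum_insert ha, Finset.card_insert_of_notMem ha, Finset.set_biUnion_insert]
    have h1 := measureReal_union_add_inter (μ := P) (s := X a) (t := ⋃ b ∈ A, X b)
      (Finset.measurableSet_biUnion _ fun b _ => hX b) (measure_ne_top _ _) (measure_ne_top _ _)
    have h2 : P.real (X a ∩ ⋃ b ∈ A, X b) ≤ A.card * c := by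
      rw [Set.inter_iUnion₂]
      refine (measureReal_biUnion_finset_le A _).trans ?_
      rw [← nsmul_eq_mul]
      exact Finset.sum_le_card_nsmul _ _ _ fun b hb => h a b fun hab => ha (hab ▸ hb)
    push_cast
    nlinarith [mul_nonneg (Nat.cast_nonneg (α := ℝ) A.card) hc]

section FreeProductPercolation

variable {κ : Type*} [DecidableEq κ] {H : κ → Type*} [∀ i, Group (H i)] [∀ i, DecidableEq (H i)]
  {σ : κ → Type*} {f : ∀ i, σ i → H i} {p : ℝ}

/-- The generators of the free product given by generators of the factors. -/
def freeGens (f : ∀ i, σ i → H i) : (Σ i, σ i) → CoprodI H :=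
  fun s => CoprodI.of (f s.1 s.2)

/-- The embedding of the edges of the Cayley graph of `H i` onto those of the coset `z * H i`. -/
def cosetEdge (i : κ) (z : CoprodI H) (e : H i × σ i) : CoprodI H × (Σ i, σ i) :=
  (z * CoprodI.of e.1, ⟨i, e.2⟩)

omit [DecidableEq κ] [∀ i, DecidableEq (H i)] in
lemma cosetEdge_injective (i : κ) (z : CoprodI H) :
    Function.Injective (cosetEdge (σ := σ) i z) := by
  classical
  rintro ⟨a, s⟩ ⟨b, t⟩ h
  simp only [cosetEdge, Prod.mk.injEq, mul_right_inj, Sigma.mk.injEq, heq_eq_eq, true_and] at h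
  rw [CoprodI.of_injective i h.1, h.2]

omit [DecidableEq κ] [∀ i, DecidableEq (H i)] in
lemma Conn.of_coset {i : κ} {z : CoprodI H} {ω : Config (CoprodI H × (Σ i, σ i))} {a b : H i}
    (h : Conn (f i) (ω ∘ cosetEdge i z) a b) :
    Conn (freeGens f) ω (z * CoprodI.of a) (z * CoprodI.of b) :=
  h.map (fun a => z * CoprodI.of a) (fun s => ⟨i, s⟩)
    (fun a s => by simp [freeGens, mul_assoc]) fun _ _ h => h

/-- An edge within the coset `y⁻¹ * H i` projects to an edge of `H i`, and any other edge projects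
to a point. -/
lemma syl_edge (i : κ) (y c : CoprodI H) (s : Σ i, σ i) :
    (∃ t, (c, s) = cosetEdge i y⁻¹ (syl i (y * c), t) ∧
      syl i (y * (c * freeGens f s)) = syl i (y * c) * f i t) ∨
    ((c, s) ∉ Set.range (cosetEdge i y⁻¹) ∧
      syl i (y * (c * freeGens f s)) = syl i (y * c)) := by
  by_cases h : (c, s) ∈ Set.range (cosetEdge (σ := σ) i y⁻¹)
  · obtain ⟨⟨u, t⟩, hu⟩ := h
    obtain ⟨rfl, rfl⟩ := Prod.mk.inj hu
    refine Or.inl ⟨t, ?_, ?_⟩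
    · simp [cosetEdge]
    · simp [freeGens, mul_assoc, ← map_mul]
  · refine Or.inr ⟨h, ?_⟩
    rw [← mul_assoc]
    rcases syl_mul_of (y * c) i s.1 (f s.1 s.2) with e | ⟨e, e'⟩
    · exact e
    · obtain ⟨j, t⟩ := s
      obtain rfl : j = i := e
      exact absurd ⟨(syl j (y * c), t), by simp [cosetEdge, ← e']⟩ h

/-- `y⁻¹` separates the identity from the rest of the coset `y⁻¹ * H i`. -/
lemma conn_coset_iff {i : κ} {y : CoprodI H} (hy : syl i y = 1) (h : H i)
    (ω : Config (CoprodI H × (Σ i, σ i))) :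
    Conn (freeGens f) ω 1 (y⁻¹ * CoprodI.of h) ↔
      Conn (freeGens f) (extendClosed (K := (Set.range (cosetEdge i y⁻¹))ᶜ) (ω ∘ Subtype.val))
        1 y⁻¹ ∧ Conn (f i) (ω ∘ cosetEdge i y⁻¹) 1 h := by
  set ω' := extendClosed (K := (Set.range (cosetEdge (σ := σ) i y⁻¹))ᶜ) (ω ∘ Subtype.val) with hω'
  constructor
  · intro hc
    suffices key : ∀ x, Conn (freeGens f) ω 1 x → Conn (f i) (ω ∘ cosetEdge i y⁻¹) 1 (syl i (y * x))
        ∧ ((Conn (freeGens f) ω' 1 x ∧ syl i (y * x) = 1) ∨ Conn (freeGens f) ω' 1 y⁻¹) by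
      obtain ⟨h1, h2⟩ := key _ hc
      simp only [mul_inv_cancel_left, syl_of] at h1 h2
      refine ⟨?_, h1⟩
      rcases h2 with ⟨h2, rfl⟩ | h2
      · simpa using h2
      · exact h2
    intro x hx
    induction hx with
    | refl => exact ⟨by rw [mul_one, hy]; exact Relation.ReflTransGen.refl,
        Or.inl ⟨Relation.ReflTransGen.refl, by rw [mul_one, hy]⟩⟩
    | @tail a b _ hs ih =>
      obtain ⟨ih1, ih2⟩ := ih
      obtain ⟨s, ⟨ho, rfl⟩ | ⟨ho, rfl⟩⟩ := hs
      · rcases syl_edge (f := f) i y a s with ⟨t, h1, h2⟩ | ⟨h1, h2⟩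
        · refine ⟨ih1.tail ⟨t, Or.inl ⟨by rw [← ho, h1]; rfl, h2⟩⟩, Or.inr ?_⟩
          rcases ih2 with ⟨h3, h4⟩ | h3
          · rw [h4] at h1
            obtain rfl : a = y⁻¹ := by simpa [cosetEdge] using (Prod.mk.inj h1).1
            exact h3
          · exact h3
        · rw [h2]
          exact ⟨ih1, ih2.imp_left fun ⟨h3, h4⟩ =>
            ⟨h3.tail ⟨s, Or.inl ⟨extendClosed_eq_true.2 ⟨h1, ho⟩, rfl⟩⟩, h4⟩⟩
      · rcases syl_edge (f := f) i y b s with ⟨t, h1, h2⟩ | ⟨h1, h2⟩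
        · refine ⟨ih1.tail ⟨t, Or.inr ⟨by rw [← ho, h1]; rfl, h2⟩⟩, Or.inr ?_⟩
          rcases ih2 with ⟨h3, h4⟩ | h3
          · obtain ⟨j, t'⟩ := s
            obtain ⟨h5, h6⟩ := Prod.mk.inj h1
            obtain rfl : j = i := congrArg Sigma.fst h6
            obtain rfl : t' = t := by simpa using h6
            have h7 : b * freeGens f ⟨j, t'⟩ = y⁻¹ := by
              rw [h5, freeGens, mul_assoc, ← map_mul, ← h2, h4, map_one, mul_one]
            rwa [h7] at h3
          · exact h3
        · rw [h2] at ih1 ih2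
          exact ⟨ih1, ih2.imp_left fun ⟨h3, h4⟩ =>
            ⟨h3.tail ⟨s, Or.inr ⟨extendClosed_eq_true.2 ⟨h1, ho⟩, rfl⟩⟩, h4⟩⟩
  · rintro ⟨h1, h2⟩
    have h3 := h2.of_coset
    rw [map_one, mul_one] at h3
    refine (h1.mono fun e he => ?_).trans h3
    obtain ⟨_, he⟩ := extendClosed_eq_true.1 he
    exact he

variable [Countable κ] [∀ i, Countable (H i)] [∀ i, Countable (σ i)]

instance : Countable (CoprodI H) := by
  have : Function.Injective fun x : CoprodI H => (CoprodI.Word.equiv x).toList := fun x y h =>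
    CoprodI.Word.equiv.injective (CoprodI.Word.ext h)
  exact this.countable

lemma tau_inv_mul_of (hp : p ∈ Set.Icc (0 : ℝ) 1) {i : κ} {y : CoprodI H} (hy : syl i y = 1)
    (h : H i) : tau (freeGens f) p (y⁻¹ * CoprodI.of h) =
      tau (freeGens f) p y⁻¹ * tau (f i) p h := by
  have key : ∀ h : H i, tau (freeGens f) p (y⁻¹ * CoprodI.of h) =
      bern ↥(Set.range (cosetEdge (σ := σ) i y⁻¹))ᶜ p
        {η | Conn (freeGens f) (extendClosed η) 1 y⁻¹} * tau (f i) p h := by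
    intro h
    refine (congrArg _ (Set.ext fun ω => conn_coset_iff hy h ω)).trans
      (bern_inter_comp hp Subtype.val_injective (cosetEdge_injective i y⁻¹)
      (fun (a : ↥(Set.range (cosetEdge (σ := σ) i y⁻¹))ᶜ) b hab => a.2 ⟨b, hab.symm⟩)
      (measurable_extendClosed (measurableSet_conn (freeGens f) 1 y⁻¹))
      (measurableSet_conn (f i) 1 h))
  have h1 := key 1
  rw [map_one, mul_one, tau_one, mul_one] at h1
  rw [key h, h1]

/-- The edges of the Cayley graph of the free product lying in the branch at the identity
consisting of the elements whose normal form does not begin in `H k`. -/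
def branch (H : κ → Type*) [∀ i, Group (H i)] [∀ i, DecidableEq (H i)] (σ : κ → Type*) (k : κ) :
    Set (CoprodI H × (Σ i, σ i)) :=
  {e | syl k e.1 = 1 ∧ ¬ (e.1 = 1 ∧ e.2.1 = k)}

/-- The translate by `z` of the branch avoiding `H k`. -/
def branchEdge (k : κ) (z : CoprodI H) (e : branch H σ k) : CoprodI H × (Σ i, σ i) :=
  (z * e.1.1, e.1.2)

/-- The probability that the cluster of the identity in the branch avoiding `H k` has at least `n`
elements. -/
noncomputable def branchProb (f : ∀ i, σ i → H i) (p : ℝ) (k : κ) (n : ℕ) : ℝ≥0∞ :=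
  bern (branch H σ k) p {η | (n : ℕ∞) ≤ (cluster (freeGens f) (extendClosed η)).encard}

omit [Countable κ] [∀ i, Countable (H i)] [∀ i, Countable (σ i)] in
lemma branchEdge_injective (k : κ) (z : CoprodI H) :
    Function.Injective (branchEdge (σ := σ) k z) := by
  rintro ⟨⟨a, s⟩, ha⟩ ⟨⟨b, t⟩, hb⟩ h
  simpa [branchEdge] using h

omit [Countable κ] [∀ i, Countable (H i)] [∀ i, Countable (σ i)] in
lemma syl_branchEdge {i : κ} (g : H i) (e : branch H σ i) :
    syl i (branchEdge i (CoprodI.of g) e).1 = g := by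
  rw [branchEdge, syl_of_mul, e.2.1, mul_one]

omit [Countable κ] [∀ i, Countable (H i)] [∀ i, Countable (σ i)] in
lemma cosetEdge_ne_branchEdge {i : κ} (g : H i) (a : H i × σ i) (e : branch H σ i) :
    cosetEdge i 1 a ≠ branchEdge i (CoprodI.of g) e := by
  intro h
  have h1 := syl_branchEdge g e
  rw [← h, cosetEdge, one_mul, syl_of] at h1
  obtain ⟨h2, h3⟩ := Prod.mk.inj h
  rw [h1, one_mul, left_eq_mul] at h2
  exact e.2.2 ⟨h2, h3 ▸ rfl⟩

omit [Countable κ] [∀ i, Countable (H i)] [∀ i, Countable (σ i)] in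
/-- Within the branch avoiding `H k`, the cluster of the identity does not meet `H k` again. -/
lemma syl_eq_one_of_conn {k : κ} {η : Config (branch H σ k)} {x : CoprodI H}
    (h : Conn (freeGens f) (extendClosed η) 1 x) : syl k x = 1 := by
  have key : ∀ a s, (a, s) ∈ branch H σ k → syl k (a * freeGens f s) = 1 := by
    rintro a s ⟨h1, h2⟩
    rcases syl_mul_of a k s.1 (f s.1 s.2) with e | ⟨e, e'⟩
    · exact e.trans h1
    · exact absurd ⟨by rw [e']; simp only [h1, map_one], e⟩ h2
  induction h with
  | refl => simp
  | tail _ hs ih =>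
    obtain ⟨s, ⟨ho, rfl⟩ | ⟨ho, rfl⟩⟩ := hs
    · exact key _ _ (extendClosed_eq_true.1 ho).1
    · exact (extendClosed_eq_true.1 ho).1.1

omit [Countable κ] [∀ i, Countable (H i)] [∀ i, Countable (σ i)] in
/-- The cluster in a branch contains the clusters in its sub-branches at the points reached within
the first factor. -/
lemma succ_le_encard_cluster_branch {i k : κ} (hik : i ≠ k) {g : H i} (hg : g ≠ 1) {n : ℕ}
    {ω : Config (CoprodI H × (Σ i, σ i))} (h1 : Conn (f i) (ω ∘ cosetEdge i 1) 1 g)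
    (h2 : (n : ℕ∞) ≤
      (cluster (freeGens f) (extendClosed (ω ∘ branchEdge i (CoprodI.of g)))).encard) :
    ((n + 1 : ℕ) : ℕ∞) ≤ (cluster (freeGens f)
      (extendClosed (ω ∘ (Subtype.val : branch H σ k → _)))).encard := by
  set D := cluster (freeGens f) (extendClosed (ω ∘ branchEdge (σ := σ) i (CoprodI.of g))) with hD
  set C := cluster (freeGens f) (extendClosed (ω ∘ (Subtype.val : branch H σ k → _))) with hC
  have hinj : Function.Injective fun x : CoprodI H => CoprodI.of g * x := mul_right_injective _
  have hconn : Conn (freeGens f) (extendClosed (ω ∘ (Subtype.val : branch H σ k → _))) 1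
      (CoprodI.of g) := by
    have := h1.map (f' := freeGens f)
      (ω' := extendClosed (ω ∘ (Subtype.val : branch H σ k → _)))
      (fun a => CoprodI.of a) (fun s => ⟨i, s⟩) (fun a s => by simp [freeGens]) fun a s h => by
        refine extendClosed_eq_true.2 ⟨⟨?_, fun h => hik h.2⟩, ?_⟩
        · by_cases ha : a = 1
          · simp [ha]
          · exact syl_eq_one_of_ne hik.symm (by rwa [syl_of])
        · simpa [cosetEdge] using h
    simp only [map_one] at this
    exact this
  have hsub : insert 1 ((fun x => CoprodI.of g * x) '' D) ⊆ C := by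
    refine Set.insert_subset Relation.ReflTransGen.refl ?_
    rintro _ ⟨x, hx, rfl⟩
    refine hconn.trans ?_
    have := Conn.map (f' := freeGens f)
      (ω' := extendClosed (ω ∘ (Subtype.val : branch H σ k → _)))
      (fun x => CoprodI.of g * x) id (fun a s => by simp [mul_assoc]) (fun a s h => by
        obtain ⟨h3, h4⟩ := extendClosed_eq_true.1 h
        have h5 : syl i (CoprodI.of g * a) ≠ 1 := by rwa [syl_of_mul, h3.1, mul_one]
        exact extendClosed_eq_true.2
          ⟨⟨syl_eq_one_of_ne hik.symm h5, fun h6 => h5 (by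
            rw [show CoprodI.of g * a = 1 from h6.1, syl_one])⟩, h4⟩) hx
    simp only [mul_one] at this
    exact this
  have hnot : (1 : CoprodI H) ∉ (fun x => CoprodI.of g * x) '' D := by
    rintro ⟨x, hx, hx1⟩
    have h3 : syl i x = 1 := syl_eq_one_of_conn hx
    have h4 := congrArg (syl i) hx1
    simp only [syl_of_mul, h3, mul_one, syl_one] at h4
    exact hg h4
  refine le_trans ?_ (Set.encard_le_encard hsub)
  rw [Set.encard_insert_of_notMem hnot, hinj.encard_image]
  push_cast
  gcongr

omit [Countable κ] [∀ i, Countable (H i)] [∀ i, Countable (σ i)] in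
lemma branchProb_zero (f : ∀ i, σ i → H i) (p : ℝ) (k : κ) : branchProb f p k 0 = 1 := by
  simp [branchProb]

lemma branchProb_eq_val (hp : p ∈ Set.Icc (0 : ℝ) 1) (k : κ) (n : ℕ) :
    bern (CoprodI H × (Σ i, σ i)) p {ω | (n : ℕ∞) ≤ (cluster (freeGens f)
      (extendClosed (ω ∘ (Subtype.val : branch H σ k → _)))).encard} = branchProb f p k n :=
  bern_preimage_comp hp Subtype.val_injective
    (measurable_extendClosed (measurableSet_le_encard_cluster (freeGens f) n))

/-- The event that `g` is reached within `H i` and the branch at `g` reaches `n` vertices. -/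
def branchEvent (f : ∀ i, σ i → H i) (i : κ) (n : ℕ) (g : H i) :
    Set (Config (CoprodI H × (Σ i, σ i))) :=
  {ω | Conn (f i) (ω ∘ cosetEdge i 1) 1 g ∧ (n : ℕ∞) ≤
    (cluster (freeGens f) (extendClosed (ω ∘ branchEdge i (CoprodI.of g)))).encard}

lemma measurableSet_branchEvent (f : ∀ i, σ i → H i) (i : κ) (n : ℕ) (g : H i) :
    MeasurableSet (branchEvent f i n g) := by
  have h1 : Measurable fun ω : Config (CoprodI H × (Σ i, σ i)) => ω ∘ cosetEdge i 1 := by fun_prop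
  have h2 : Measurable fun ω : Config (CoprodI H × (Σ i, σ i)) =>
      ω ∘ branchEdge i (CoprodI.of g) := by fun_prop
  exact (h1 (measurableSet_conn (f i) 1 g)).inter
    (h2 (measurable_extendClosed (measurableSet_le_encard_cluster (freeGens f) n)))

lemma bern_branchEvent (hp : p ∈ Set.Icc (0 : ℝ) 1) (i : κ) (n : ℕ) (g : H i) :
    bern _ p (branchEvent f i n g) = tau (f i) p g * branchProb f p i n :=
  bern_inter_comp hp (cosetEdge_injective i 1) (branchEdge_injective i _)
    (cosetEdge_ne_branchEdge g) (measurableSet_conn (f i) 1 g)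
    (measurable_extendClosed (measurableSet_le_encard_cluster (freeGens f) n))

lemma bern_branchEvent_inter_le (hp : p ∈ Set.Icc (0 : ℝ) 1) (i : κ) (n : ℕ) {g h : H i}
    (hgh : g ≠ h) :
    bern _ p (branchEvent f i n g ∩ branchEvent f i n h) ≤ branchProb f p i n ^ 2 := by
  have hm := measurable_extendClosed (K := branch H σ i)
    (measurableSet_le_encard_cluster (freeGens f) n)
  have := bern_inter_comp hp (branchEdge_injective i (CoprodI.of g))
    (branchEdge_injective (σ := σ) i (CoprodI.of h))
    (fun a b hab => hgh (by rw [← syl_branchEdge g a, hab, syl_branchEdge])) hm hm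
  rw [sq]
  refine le_trans (measure_mono ?_) this.le
  rintro ω ⟨h1, h2⟩
  exact ⟨h1.2, h2.2⟩

lemma branchProb_succ_pos (hp : p ∈ Set.Icc (0 : ℝ) 1) {i k : κ} (hik : i ≠ k) (n : ℕ)
    (hτ : 0 < tauSum (f i) p) (hn : 0 < branchProb f p i n) : 0 < branchProb f p k (n + 1) := by
  obtain ⟨⟨g, hg⟩, hg'⟩ : ∃ g : {g : H i // g ≠ 1}, tau (f i) p g ≠ 0 := by
    by_contra! h
    simp [tauSum, h] at hτ
  refine lt_of_lt_of_le (b := bern _ p (branchEvent f i n g)) ?_ ?_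
  · rw [bern_branchEvent hp]
    exact pos_iff_ne_zero.2 (mul_ne_zero hg' hn.ne')
  · rw [← branchProb_eq_val hp]
    exact measure_mono fun ω hω => succ_le_encard_cluster_branch hik hg hω.1 hω.2

lemma branchProb_ge (hp : p ∈ Set.Icc (0 : ℝ) 1) {i k : κ} (hik : i ≠ k) (n : ℕ)
    (A : Finset {g : H i // g ≠ 1}) :
    (branchProb f p i n).toReal * (∑ g ∈ A, (tau (f i) p g).toReal -
      (A.card : ℝ) ^ 2 * (branchProb f p i n).toReal) ≤ (branchProb f p k n).toReal := by
  have hne : branchProb f p i n ≠ ⊤ := ne_top_of_le_ne_top one_ne_top prob_le_one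
  have hB := sum_measureReal_le (P := bern _ p)
    (X := fun g : {g : H i // g ≠ 1} => branchEvent f i n g)
    (fun g => measurableSet_branchEvent f i n g) (c := (branchProb f p i n).toReal ^ 2)
    (by positivity) A fun g h hgh => by
      rw [measureReal_def, ← ENNReal.toReal_pow]
      exact ENNReal.toReal_mono (by finiteness)
        (bern_branchEvent_inter_le hp i n fun e => hgh (Subtype.ext e))
  have hU : (bern _ p).real (⋃ g ∈ A, branchEvent f i n (g : H i)) ≤
      (branchProb f p k n).toReal := by
    rw [← branchProb_eq_val hp]
    refine ENNReal.toReal_mono (measure_ne_top _ _) (measure_mono ?_)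
    refine Set.iUnion₂_subset fun g _ ω hω => ?_
    refine le_trans ?_ (succ_le_encard_cluster_branch hik g.2 hω.1 hω.2)
    exact_mod_cast n.le_succ
  simp only [measureReal_def, bern_branchEvent hp, ENNReal.toReal_mul, ← Finset.sum_mul] at hB hU
  nlinarith

/-- If there is almost surely no infinite cluster, large branches are unlikely. -/
lemma tendsto_branchProb (hp : p ∈ Set.Icc (0 : ℝ) 1)
    (h0 : theta (freeGens f) (bern _ p) = 0) (k : κ) :
    Filter.Tendsto (fun n => (branchProb f p k n).toReal) Filter.atTop (nhds 0) := by
  have hmeas : ∀ n : ℕ, MeasurableSet {ω : Config (CoprodI H × (Σ i, σ i)) | (n : ℕ∞) ≤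
      (cluster (freeGens f) (extendClosed (ω ∘ (Subtype.val : branch H σ k → _)))).encard} := by
    intro n
    have h1 : Measurable fun ω : Config (CoprodI H × (Σ i, σ i)) =>
      ω ∘ (Subtype.val : branch H σ k → _) := by fun_prop
    exact h1 (measurable_extendClosed (measurableSet_le_encard_cluster (freeGens f) n))
  have := tendsto_measure_iInter_atTop (μ := bern (CoprodI H × (Σ i, σ i)) p)
    (fun n => (hmeas n).nullMeasurableSet)
    (fun m n hmn ω (hω : (n : ℕ∞) ≤ _) => le_trans (by exact_mod_cast hmn) hω)
    ⟨0, measure_ne_top _ _⟩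
  replace this := this.congr fun n => branchProb_eq_val (f := f) hp k n
  have hz : bern (CoprodI H × (Σ i, σ i)) p (⋂ n : ℕ, {ω | (n : ℕ∞) ≤
      (cluster (freeGens f)
        (extendClosed (ω ∘ (Subtype.val : branch H σ k → _)))).encard}) = 0 := by
    rw [theta, ENNReal.toReal_eq_zero_iff] at h0
    refine measure_mono_null ?_ (h0.resolve_right (measure_ne_top _ _))
    intro ω hω
    have htop : (cluster (freeGens f)
        (extendClosed (ω ∘ (Subtype.val : branch H σ k → _)))).encard = ⊤ :=
      ENat.eq_top_iff_forall_ge.2 fun n => Set.mem_iInter.1 hω n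
    refine (Set.encard_eq_top_iff.1 htop).mono fun x hx => Conn.mono (fun e he => ?_) hx
    exact (extendClosed_eq_true.1 he).2
  rw [hz] at this
  exact (ENNReal.tendsto_toReal zero_ne_top).comp this

end FreeProductPercolation

lemma tsum_subtype_eq_tsum_ite {α : Type*} (P : α → Prop) [DecidablePred P] (u : α → ℝ≥0∞) :
    ∑' y : {y // P y}, u y = ∑' y, if P y then u y else 0 := by
  refine (tsum_subtype {y | P y} u).trans (tsum_congr fun y => ?_)
  by_cases h : P y <;> simp [h]

section Subcritical

variable {κ : Type*} [DecidableEq κ] {H : κ → Type*} [∀ i, Group (H i)] [∀ i, DecidableEq (H i)]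
  {σ : κ → Type*} {f : ∀ i, σ i → H i} {p : ℝ}
  [Countable κ] [∀ i, Countable (H i)] [∀ i, Countable (σ i)]

lemma branchProb_pos (hp : p ∈ Set.Icc (0 : ℝ) 1) {i k : κ} (hik : i ≠ k)
    (hi : 0 < tauSum (f i) p) (hk : 0 < tauSum (f k) p) (n : ℕ) :
    0 < branchProb f p i n ∧ 0 < branchProb f p k n := by
  induction n with
  | zero => simp [branchProb_zero]
  | succ n ih =>
    exact ⟨branchProb_succ_pos hp hik.symm n hk ih.2, branchProb_succ_pos hp hik n hi ih.1⟩

lemma sum_tau_mul_sum_tau_le_one (hp : p ∈ Set.Icc (0 : ℝ) 1)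
    (h0 : theta (freeGens f) (bern _ p) = 0) {i k : κ} (hik : i ≠ k)
    (hi : 0 < tauSum (f i) p) (hk : 0 < tauSum (f k) p)
    (A : Finset {g : H i // g ≠ 1}) (B : Finset {g : H k // g ≠ 1}) :
    (∑ g ∈ A, (tau (f i) p g).toReal) * (∑ g ∈ B, (tau (f k) p g).toReal) ≤ 1 := by
  set S := ∑ g ∈ A, (tau (f i) p g).toReal with hS
  set T := ∑ g ∈ B, (tau (f k) p g).toReal with hT
  have hS0 : 0 ≤ S := Finset.sum_nonneg fun _ _ => ENNReal.toReal_nonneg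
  by_contra! hlt
  have hS1 : 0 < S := hS0.lt_of_ne (by rintro h; rw [← h] at hlt; linarith)
  have h1 : Filter.Tendsto (fun n => S - (A.card : ℝ) ^ 2 * (branchProb f p i n).toReal)
      Filter.atTop (nhds S) := by
    simpa using ((tendsto_branchProb hp h0 i).const_mul ((A.card : ℝ) ^ 2)).const_sub S
  have h2 : Filter.Tendsto (fun n => T - (B.card : ℝ) ^ 2 * (branchProb f p k n).toReal)
      Filter.atTop (nhds T) := by
    simpa using ((tendsto_branchProb hp h0 k).const_mul ((B.card : ℝ) ^ 2)).const_sub T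
  obtain ⟨n, h3, h4⟩ := ((h1.eventually_const_lt hS1).and
    ((h1.mul h2).eventually_const_lt hlt)).exists
  have h5 := branchProb_ge (f := f) hp hik n A
  have h6 := branchProb_ge (f := f) hp hik.symm n B
  have h7 : 0 < (branchProb f p k n).toReal :=
    ENNReal.toReal_pos (branchProb_pos hp hik hi hk n).2.ne'
      (ne_top_of_le_ne_top one_ne_top prob_le_one)
  rw [← hS] at h5
  rw [← hT] at h6
  have h8 := mul_le_mul_of_nonneg_right h6 h3.le
  nlinarith [mul_lt_mul_of_pos_left h4 h7]

/-- In the absence of an infinite cluster, the expected numbers of further vertices reached within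
two factors have product at most `1`. -/
lemma tauSum_mul_tauSum_le_one (hp : p ∈ Set.Icc (0 : ℝ) 1)
    (h0 : theta (freeGens f) (bern _ p) = 0) {i k : κ} (hik : i ≠ k)
    (hi : 0 < tauSum (f i) p) (hk : 0 < tauSum (f k) p) :
    tauSum (f i) p * tauSum (f k) p ≤ 1 := by
  have hne : ∀ (j : κ) (g : H j), tau (f j) p g ≠ ⊤ := fun j g =>
    ne_top_of_le_ne_top one_ne_top (tau_le_one _ _ _)
  rw [tauSum, tauSum, ENNReal.tsum_eq_iSup_sum, ENNReal.iSup_mul]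
  refine iSup_le fun A => ?_
  rw [ENNReal.tsum_eq_iSup_sum, ENNReal.mul_iSup]
  refine iSup_le fun B => ?_
  have := sum_tau_mul_sum_tau_le_one hp h0 hik hi hk A B
  rw [← ENNReal.toReal_sum fun (g : {g : H i // g ≠ 1}) _ => hne i g,
    ← ENNReal.toReal_sum fun (g : {g : H k // g ≠ 1}) _ => hne k g, ← ENNReal.toReal_mul] at this
  have hfin : (∑ g ∈ A, tau (f i) p g) * (∑ g ∈ B, tau (f k) p g) ≠ ⊤ :=
    ENNReal.mul_ne_top (ENNReal.sum_ne_top.2 fun g _ => hne i g)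
      (ENNReal.sum_ne_top.2 fun g _ => hne k g)
  rwa [← ENNReal.toReal_le_toReal hfin one_ne_top, ENNReal.toReal_one]

lemma tau_of_mul_inv (hp : p ∈ Set.Icc (0 : ℝ) 1) {i : κ} {y : CoprodI H} (hy : syl i y = 1)
    (h : H i) : tau (freeGens f) p (CoprodI.of h * y)⁻¹ =
      tau (f i) p h⁻¹ * tau (freeGens f) p y⁻¹ := by
  rw [mul_inv_rev, ← map_inv, tau_inv_mul_of hp hy, mul_comm]

/-- The expected number of elements of the cluster of the identity whose inverse has a normal form
that does not begin in `H i`. -/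
noncomputable def armSum (f : ∀ i, σ i → H i) (p : ℝ) (i : κ) : ℝ≥0∞ :=
  ∑' y : {y : CoprodI H // syl i y = 1}, tau (freeGens f) p (y : CoprodI H)⁻¹

omit [Countable κ] [∀ i, Countable (H i)] [∀ i, Countable (σ i)] in
lemma tsum_sylEquiv (i : κ) (u : CoprodI H → ℝ≥0∞) :
    ∑' x, u x =
      ∑' (h : H i) (y : {y : CoprodI H // syl i y = 1}), u (CoprodI.of h * (y : CoprodI H)) := by
  rw [← (sylEquiv i).symm.tsum_eq]
  exact ENNReal.tsum_prod (f := fun h (y : {y : CoprodI H // syl i y = 1}) =>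
    u (CoprodI.of h * (y : CoprodI H)))

lemma tsum_tau_freeGens (hp : p ∈ Set.Icc (0 : ℝ) 1) (i : κ) :
    ∑' x, tau (freeGens f) p x = (1 + tauSum (f i) p) * armSum f p i := by
  rw [← (Equiv.inv (CoprodI H)).tsum_eq, tsum_sylEquiv i]
  simp only [Equiv.inv_apply]
  simp_rw [fun h (y : {y : CoprodI H // syl i y = 1}) => tau_of_mul_inv (f := f) hp y.2 h,
    ENNReal.tsum_mul_left, ENNReal.tsum_mul_right]
  have h1 := (Equiv.inv (H i)).tsum_eq (tau (f i) p)
  simp only [Equiv.inv_apply] at h1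
  rw [h1, tsum_tau, armSum]

omit [Countable κ] [∀ i, Countable (H i)] [∀ i, Countable (σ i)] in
lemma armSum_eq_tsum_ite (i : κ) : armSum f p i =
    ∑' y : CoprodI H, if syl i y = 1 then tau (freeGens f) p y⁻¹ else 0 := by
  exact tsum_subtype_eq_tsum_ite (fun y : CoprodI H => syl i y = 1)
    fun y => tau (freeGens f) p y⁻¹

/-- `armSum` restricted to normal forms with fewer than `n` syllables. -/
noncomputable def armSumLt (f : ∀ i, σ i → H i) (p : ℝ) (i : κ) (n : ℕ) : ℝ≥0∞ :=
  ∑' y : {y : CoprodI H // syl i y = 1},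
    if wlen (y : CoprodI H) < n then tau (freeGens f) p (y : CoprodI H)⁻¹ else 0

omit [Countable κ] [∀ i, Countable (H i)] [∀ i, Countable (σ i)] in
lemma armSum_le_of_armSumLt_le {i : κ} {B : ℝ≥0∞} (hB : ∀ n, armSumLt f p i n ≤ B) :
    armSum f p i ≤ B := by
  rw [armSum, ENNReal.tsum_eq_iSup_sum]
  refine iSup_le fun s => le_trans ?_ (hB (s.sup (fun y => wlen (y : CoprodI H)) + 1))
  refine le_trans (Finset.sum_le_sum fun y hy => ?_) (ENNReal.sum_le_tsum s)
  rw [if_pos (Nat.lt_succ_of_le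
    (Finset.le_sup (f := fun y : {y : CoprodI H // syl i y = 1} => wlen (y : CoprodI H)) hy))]

end Subcritical

section TwoFactors

variable {H : Bool → Type*} [∀ i, Group (H i)] [∀ i, DecidableEq (H i)]
  {σ : Bool → Type*} {f : ∀ i, σ i → H i} {p : ℝ}
  [∀ i, Countable (H i)] [∀ i, Countable (σ i)]

omit [∀ i, Countable (H i)] in
lemma eq_one_of_syl_eq_one_of_syl_not_eq_one {i : Bool} {y : CoprodI H} (h : syl i y = 1)
    (h' : syl (!i) y = 1) : y = 1 :=
  eq_one_of_syl_eq_one fun j => by cases i <;> cases j <;> assumption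

lemma armSumLt_succ_le (hp : p ∈ Set.Icc (0 : ℝ) 1) (i : Bool) (n : ℕ) :
    armSumLt f p i (n + 1) ≤ 1 + tauSum (f (!i)) p * armSumLt f p (!i) n := by
  set u : CoprodI H → ℝ≥0∞ := fun y =>
    if syl i y = 1 ∧ wlen y < n + 1 then tau (freeGens f) p y⁻¹ else 0 with hu
  set v : H (!i) → ℝ≥0∞ := fun h =>
    if h = 1 then 1 else tau (f (!i)) p h * armSumLt f p (!i) n with hv
  have h1 : armSumLt f p i (n + 1) = ∑' y, u y := by
    simp only [hu, ite_and]
    exact tsum_subtype_eq_tsum_ite (fun y : CoprodI H => syl i y = 1)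
      fun y => if wlen y < n + 1 then tau (freeGens f) p y⁻¹ else 0
  have h2 : ∀ h, ∑' y : {y : CoprodI H // syl (!i) y = 1},
      u (CoprodI.of h * (y : CoprodI H)) ≤ v h⁻¹ := by
    intro h
    by_cases hh : h = 1
    · subst hh
      rw [tsum_eq_single ⟨1, syl_one _⟩]
      · simp only [hu, hv, inv_one, if_true]
        split_ifs
        · exact tau_le_one _ _ _
        · exact zero_le_one
      · intro y hy
        rw [map_one, one_mul, hu]
        exact if_neg fun h => hy (Subtype.ext (eq_one_of_syl_eq_one_of_syl_not_eq_one h.1 y.2))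
    · simp only [hv, inv_eq_one, if_neg hh]
      rw [armSumLt, ← ENNReal.tsum_mul_left]
      refine ENNReal.tsum_le_tsum fun y => ?_
      simp only [hu, wlen_of_mul hh y.2, add_lt_add_iff_right, tau_of_mul_inv hp y.2]
      split_ifs <;> simp_all
  have h3 : ∑' h, v h = 1 + tauSum (f (!i)) p * armSumLt f p (!i) n := by
    rw [← (Summable.tsum_add_tsum_compl (s := ({1} : Set (H (!i)))) ENNReal.summable
      ENNReal.summable), tsum_singleton (1 : H (!i)) v, tauSum, ← ENNReal.tsum_mul_right]
    simp only [hv, if_true]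
    congr 1
    exact tsum_congr fun h => if_neg h.2
  rw [h1, tsum_sylEquiv (!i), ← h3, ← (Equiv.inv (H (!i))).tsum_eq v]
  exact ENNReal.tsum_le_tsum h2

lemma armSum_ne_top (hp : p ∈ Set.Icc (0 : ℝ) 1) (hfin : ∀ i, tauSum (f i) p ≠ ⊤)
    (hlt : ∀ i, tauSum (f i) p * tauSum (f (!i)) p < 1) (i : Bool) : armSum f p i ≠ ⊤ := by
  set r := tauSum (f i) p * tauSum (f (!i)) p with hr
  set D : ℝ≥0∞ := ∑' n : ℕ, r ^ n with hD
  have hDtop : D ≠ ⊤ := by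
    rw [hD, ENNReal.tsum_geometric]
    exact ENNReal.inv_ne_top.2 (tsub_pos_of_lt (hlt i)).ne'
  have hDr : D = 1 + r * D := by
    conv_lhs => rw [hD, tsum_eq_zero_add' ENNReal.summable]
    simp_rw [pow_succ', pow_zero, ENNReal.tsum_mul_left, hD]
  have key : ∀ n, armSumLt f p i n ≤ (1 + tauSum (f (!i)) p) * D ∧
      armSumLt f p (!i) n ≤ (1 + tauSum (f i) p) * D := by
    intro n
    induction n with
    | zero => simp [armSumLt]
    | succ n ih =>
      have h1 := armSumLt_succ_le (f := f) hp i n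
      have h2 := armSumLt_succ_le (f := f) hp (!i) n
      rw [Bool.not_not] at h2
      constructor
      · calc _ ≤ 1 + tauSum (f (!i)) p * ((1 + tauSum (f i) p) * D) := by
              refine h1.trans ?_
              gcongr
              exact ih.2
          _ = (1 + r * D) + tauSum (f (!i)) p * D := by rw [hr]; ring
          _ = _ := by rw [← hDr]; ring
      · calc _ ≤ 1 + tauSum (f i) p * ((1 + tauSum (f (!i)) p) * D) := by
              refine h2.trans ?_
              gcongr
              exact ih.1
          _ = (1 + r * D) + tauSum (f i) p * D := by rw [hr]; ring
          _ = _ := by rw [← hDr]; ring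
  exact ne_top_of_le_ne_top (ENNReal.mul_ne_top (by simp [hfin]) hDtop)
    (armSum_le_of_armSumLt_le fun n => (key n).1)

omit [∀ i, Countable (H i)] [∀ i, Countable (σ i)] in
lemma tsum_tau_freeGens_add_one (f : ∀ i, σ i → H i) (p : ℝ) :
    ∑' x, tau (freeGens f) p x + 1 = armSum f p true + armSum f p false := by
  have h1 : ∑' y : CoprodI H, (if y = 1 then 1 else 0 : ℝ≥0∞) = 1 := tsum_ite_eq 1 _
  rw [armSum_eq_tsum_ite, armSum_eq_tsum_ite, ← ENNReal.tsum_add,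
    ← (Equiv.inv (CoprodI H)).tsum_eq]
  conv_lhs => rw [← h1]
  rw [← ENNReal.tsum_add]
  refine tsum_congr fun y => ?_
  simp only [Equiv.inv_apply]
  by_cases ht : syl true y = 1
  · by_cases hf : syl false y = 1
    · obtain rfl := eq_one_of_syl_eq_one_of_syl_not_eq_one ht hf
      simp
    · have hy : y ≠ 1 := by rintro rfl; exact hf (syl_one _)
      simp [ht, hf, hy]
  · have hf : syl false y = 1 := syl_eq_one_of_ne (by decide) ht
    have hy : y ≠ 1 := by rintro rfl; exact ht (syl_one _)
    simp [ht, hf, hy]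

/-- The expected cluster size of a free product of two groups, below a parameter `q` at which there
is no infinite cluster. -/
theorem tsum_tau_freeGens_eq {q : ℝ} [∀ i, Finite (σ i)] (hf : ∀ i, ∃ s, f i s ≠ 1) (hp : 0 ≤ p)
    (hpq : p < q) (hq : q ≤ 1) (h0 : theta (freeGens f) (bern _ q) = 0) :
    (∀ i, tauSum (f i) p ≠ ⊤) ∧ (tauSum (f true) p).toReal * (tauSum (f false) p).toReal < 1 ∧
      ∑' x, tau (freeGens f) p x = ENNReal.ofReal
        ((1 + (tauSum (f true) p).toReal) * (1 + (tauSum (f false) p).toReal) /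
          (1 - (tauSum (f true) p).toReal * (tauSum (f false) p).toReal)) := by
  have hq0 : 0 < q := hp.trans_lt hpq
  have hpI : p ∈ Set.Icc (0 : ℝ) 1 := ⟨hp, hpq.le.trans hq⟩
  have hpos : ∀ i, 0 < tauSum (f i) q := fun i => (hf i).elim fun s hs => tauSum_pos hq0 hq hs
  have hle : ∀ i, tauSum (f i) q * tauSum (f (!i)) q ≤ 1 := fun i =>
    tauSum_mul_tauSum_le_one ⟨hq0.le, hq⟩ h0 (by simp) (hpos _) (hpos _)
  have hfinq : ∀ i, tauSum (f i) q ≠ ⊤ := fun i h => by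
    have := hle i
    rw [h, ENNReal.top_mul (hpos _).ne'] at this
    simp at this
  have hstrict : ∀ i, tauSum (f i) p < tauSum (f i) q := fun i =>
    (hf i).elim fun s hs => tauSum_lt hp hpq hq hs (hfinq i)
  have hfin : ∀ i, tauSum (f i) p ≠ ⊤ := fun i => (hstrict i).ne_top
  have hlt : ∀ i, tauSum (f i) p * tauSum (f (!i)) p < 1 := fun i =>
    (ENNReal.mul_lt_mul (hstrict i) (hstrict _)).trans_le (hle i)
  have hr : (tauSum (f true) p).toReal * (tauSum (f false) p).toReal < 1 := by
    rw [← ENNReal.toReal_mul, ← ENNReal.toReal_one]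
    exact (ENNReal.toReal_lt_toReal (hlt true).ne_top one_ne_top).2 (hlt true)
  refine ⟨hfin, hr, ?_⟩
  have harm := armSum_ne_top hpI hfin hlt
  have e1 := tsum_tau_freeGens (f := f) hpI true
  have e2 := tsum_tau_freeGens (f := f) hpI false
  have e3 := tsum_tau_freeGens_add_one f p
  have hX : ∑' x, tau (freeGens f) p x ≠ ⊤ := by
    rw [e1]
    exact ENNReal.mul_ne_top (by simp [hfin]) (harm _)
  rw [← ENNReal.ofReal_toReal hX]
  congr 1
  apply_fun ENNReal.toReal at e1 e2 e3
  rw [ENNReal.toReal_mul, ENNReal.toReal_add one_ne_top (hfin _), ENNReal.toReal_one] at e1 e2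
  rw [ENNReal.toReal_add hX one_ne_top, ENNReal.toReal_add (harm _) (harm _),
    ENNReal.toReal_one] at e3
  rw [eq_div_iff (sub_pos.2 hr).ne']
  set x := (∑' x, tau (freeGens f) p x).toReal
  set a := (tauSum (f true) p).toReal
  set b := (tauSum (f false) p).toReal
  linear_combination -(1 + a) * (1 + b) * e3 + (1 + b) * e1 + (1 + a) * e2

end TwoFactors

lemma countable_of_closure_eq_top {G : Type*} [Group G] {S : Set G} (hS : S.Finite)
    (h : Subgroup.closure S = ⊤) : Countable G := by
  have : Countable S := hS.countable.to_subtype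
  have : Function.Surjective (FreeGroup.lift (Subtype.val : S → G)) := by
    rw [← MonoidHom.range_eq_top, FreeGroup.range_lift_eq_closure, Subtype.range_coe, h]
  have h2 : Countable (FreeGroup S) := Quot.mk_surjective.countable (α := List (S × Bool))
  exact this.countable

lemma exists_ne_one_of_closure_eq_top {G : Type*} [Group G] [Nontrivial G] {S : Set G}
    (h : Subgroup.closure S = ⊤) : ∃ s : S, (s : G) ≠ 1 := by
  by_contra! hs
  have : Subgroup.closure S ≤ ⊥ := (Subgroup.closure_le _).2 fun x hx => hs ⟨x, hx⟩
  rw [h] at this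
  exact bot_ne_top (le_antisymm bot_le this)

lemma chi_bern {G ι : Type*} [Group G] [Countable G] [Countable ι] (f : ι → G) (p : ℝ) :
    chi f (bern (G × ι) p) = ∑' x, tau f p x :=
  chi_eq_tsum f _

lemma theta_eq_zero_of_lt_pc {G ι : Type*} [Group G] {f : ι → G}
    {μ : ℝ → Measure (Config (G × ι))} {p : ℝ} (hp : 0 ≤ p) (h : p < pc f μ) :
    p < 1 ∧ theta f (μ p) = 0 := by
  have hbdd : BddBelow ({p | p ∈ Set.Icc (0 : ℝ) 1 ∧ 0 < theta f (μ p)} ∪ {1}) :=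
    ⟨0, by rintro x (hx | rfl) <;> [exact hx.1.1; exact zero_le_one]⟩
  have h1 : p < 1 := h.trans_le (csInf_le hbdd (Or.inr rfl))
  refine ⟨h1, le_antisymm (not_lt.1 fun h2 => ?_) ENNReal.toReal_nonneg⟩
  exact h.not_ge (csInf_le hbdd (Or.inl ⟨⟨hp, h1.le⟩, h2⟩))

/-- Two groups as a family indexed by `Bool` in a common universe. -/
lemma exists_family.{u, v} (G₁ : Type u) (G₂ : Type v) [Group G₁] [Group G₂] :
    ∃ (H : Bool → Type (max u v)) (_ : ∀ b, Group (H b)),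
      Nonempty (G₁ ≃* H true) ∧ Nonempty (G₂ ≃* H false) :=
  ⟨fun b => Bool.rec (ULift G₂) (ULift G₁) b, fun b => Bool.rec ULift.group ULift.group b,
    ⟨MulEquiv.ulift.symm⟩, ⟨MulEquiv.ulift.symm⟩⟩

/-- The binary free product as an indexed one. -/
def coprodEquiv {G₁ G₂ : Type*} [Group G₁] [Group G₂] {H : Bool → Type*} [∀ i, Group (H i)]
    (φ₁ : G₁ ≃* H true) (φ₂ : G₂ ≃* H false) : Coprod G₁ G₂ ≃* CoprodI H :=
  MonoidHom.toMulEquiv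
    (Coprod.lift (CoprodI.of.comp φ₁.toMonoidHom) (CoprodI.of.comp φ₂.toMonoidHom))
    (CoprodI.lift fun b => match b with
      | true => Coprod.inl.comp φ₁.symm.toMonoidHom
      | false => Coprod.inr.comp φ₂.symm.toMonoidHom)
    (Coprod.hom_ext (by ext; simp) (by ext; simp))
    (CoprodI.ext_hom _ _ fun b => by cases b <;> ext <;> simp)

/-- The disjoint union of two types as a family indexed by `Bool`. -/
def sumEquivSigma {A B : Type*} {σ : Bool → Type*} (e₁ : A ≃ σ true) (e₂ : B ≃ σ false) :
    A ⊕ B ≃ Σ b, σ b where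
  toFun := Sum.elim (fun s => ⟨true, e₁ s⟩) (fun s => ⟨false, e₂ s⟩)
  invFun x := match x with
    | ⟨true, s⟩ => Sum.inl (e₁.symm s)
    | ⟨false, s⟩ => Sum.inr (e₂.symm s)
  left_inv := by rintro (s | s) <;> simp
  right_inv := by rintro ⟨_ | _, s⟩ <;> simp

end Perc

open Perc

/-- For nontrivial finitely generated groups `G₁, G₂` with finite
generating sets `S₁, S₂` and `0 ≤ p < p_c(G₁ * G₂)`: the expected subcritical cluster
sizes `χ₁(p), χ₂(p)` are finite, `χ₁(p) + χ₂(p) - χ₁(p)·χ₂(p) > 0`, and the expected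
cluster size of the free product is `χ₁(p)·χ₂(p) / (χ₁(p) + χ₂(p) - χ₁(p)·χ₂(p))`. -/
theorem expected_cluster_size_free_product_two
    {G₁ G₂ : Type*} [Group G₁] [Group G₂] [Nontrivial G₁] [Nontrivial G₂]
    (S₁ : Set G₁) (S₂ : Set G₂) (hfin₁ : S₁.Finite) (hfin₂ : S₂.Finite)
    (hgen₁ : Subgroup.closure S₁ = ⊤) (hgen₂ : Subgroup.closure S₂ = ⊤)
    (μ₁ : ℝ → Measure (Config (G₁ × S₁))) (μ₂ : ℝ → Measure (Config (G₂ × S₂)))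
    (μ : ℝ → Measure (Config (Monoid.Coprod G₁ G₂ × (S₁ ⊕ S₂))))
    (hμ₁ : ∀ p ∈ Set.Icc (0 : ℝ) 1, IsBernoulli p (μ₁ p))
    (hμ₂ : ∀ p ∈ Set.Icc (0 : ℝ) 1, IsBernoulli p (μ₂ p))
    (hμ : ∀ p ∈ Set.Icc (0 : ℝ) 1, IsBernoulli p (μ p))
    (p : ℝ) (hp0 : 0 ≤ p) (hppc : p < pc (coprodGens S₁ S₂) μ) :
    chi (setGens S₁) (μ₁ p) ≠ ⊤ ∧ chi (setGens S₂) (μ₂ p) ≠ ⊤ ∧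
    0 < (chi (setGens S₁) (μ₁ p)).toReal + (chi (setGens S₂) (μ₂ p)).toReal
        - (chi (setGens S₁) (μ₁ p)).toReal * (chi (setGens S₂) (μ₂ p)).toReal ∧
    chi (coprodGens S₁ S₂) (μ p) = ENNReal.ofReal
      (((chi (setGens S₁) (μ₁ p)).toReal * (chi (setGens S₂) (μ₂ p)).toReal) /
        ((chi (setGens S₁) (μ₁ p)).toReal + (chi (setGens S₂) (μ₂ p)).toReal
          - (chi (setGens S₁) (μ₁ p)).toReal * (chi (setGens S₂) (μ₂ p)).toReal)) := by
  have hS₁ : Finite S₁ := hfin₁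
  have hS₂ : Finite S₂ := hfin₂
  have hG₁ := countable_of_closure_eq_top hfin₁ hgen₁
  have hG₂ := countable_of_closure_eq_top hfin₂ hgen₂
  obtain ⟨s₁, hs₁⟩ := exists_ne_one_of_closure_eq_top hgen₁
  obtain ⟨s₂, hs₂⟩ := exists_ne_one_of_closure_eq_top hgen₂
  classical
  obtain ⟨H, _, ⟨φ₁⟩, ⟨φ₂⟩⟩ := exists_family G₁ G₂
  obtain ⟨σ, _, ⟨e₁⟩, ⟨e₂⟩⟩ : ∃ σ : Bool → Type, (∀ b, Finite (σ b)) ∧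
      Nonempty (S₁ ≃ σ true) ∧ Nonempty (S₂ ≃ σ false) :=
    ⟨fun b => Fin (bif b then Nat.card S₁ else Nat.card S₂), fun _ => inferInstance,
      ⟨Finite.equivFin S₁⟩, ⟨Finite.equivFin S₂⟩⟩
  have hH : ∀ b, Countable (H b) := fun b => match b with
    | true => φ₁.surjective.countable
    | false => φ₂.surjective.countable
  let f : ∀ b, σ b → H b := fun b => match b with
    | true => fun s => φ₁ (e₁.symm s)
    | false => fun s => φ₂ (e₂.symm s)
  have hf : ∀ b, ∃ s, f b s ≠ 1 := fun b => match b with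
    | true => ⟨e₁ s₁, by simpa [f] using hs₁⟩
    | false => ⟨e₂ s₂, by simpa [f] using hs₂⟩
  have hgens : ∀ s, coprodEquiv φ₁ φ₂ (coprodGens S₁ S₂ s) =
      freeGens f (sumEquivSigma e₁ e₂ s) := by
    rintro (s | s) <;> simp [coprodEquiv, coprodGens, freeGens, sumEquivSigma, f] <;> rfl
  have : Countable (Monoid.Coprod G₁ G₂) := (coprodEquiv φ₁ φ₂).injective.countable
  obtain ⟨q, hpq, hqpc⟩ := exists_between hppc
  obtain ⟨hq1, hθ⟩ := theta_eq_zero_of_lt_pc (hp0.trans hpq.le) hqpc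
  have hpI : p ∈ Set.Icc (0 : ℝ) 1 := ⟨hp0, hpq.le.trans hq1.le⟩
  have hqI : q ∈ Set.Icc (0 : ℝ) 1 := ⟨hp0.trans hpq.le, hq1.le⟩
  rw [theta_congr (hμ q hqI) (isBernoulli_bern hqI) (coprodEquiv φ₁ φ₂) (sumEquivSigma e₁ e₂)
    hgens] at hθ
  rw [chi_congr (f' := f true) (hμ₁ p hpI) (isBernoulli_bern hpI) φ₁ e₁
      fun s => by simp [setGens, f],
    chi_congr (f' := f false) (hμ₂ p hpI) (isBernoulli_bern hpI) φ₂ e₂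
      fun s => by simp [setGens, f],
    chi_congr (hμ p hpI) (isBernoulli_bern hpI) (coprodEquiv φ₁ φ₂) (sumEquivSigma e₁ e₂) hgens,
    chi_bern, chi_bern, chi_bern, tsum_tau, tsum_tau]
  obtain ⟨hfin, hlt, heq⟩ := tsum_tau_freeGens_eq hf hp0 hpq hq1.le hθ
  have hden : (1 + (tauSum (f true) p).toReal) + (1 + (tauSum (f false) p).toReal) -
      (1 + (tauSum (f true) p).toReal) * (1 + (tauSum (f false) p).toReal) =
      1 - (tauSum (f true) p).toReal * (tauSum (f false) p).toReal := by ring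
  rw [ENNReal.toReal_add one_ne_top (hfin true), ENNReal.toReal_add one_ne_top (hfin false),
    ENNReal.toReal_one, hden]
  exact ⟨by simp [hfin], by simp [hfin], sub_pos.2 hlt, heq⟩
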